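/- arXiv:1708.07975 — 2 statements merged into one kernel-verified Lean document; each statement's English description precedes it below -/
import Mathlib

section
/- In the plausible-deniability mechanism setup, let t be an integer with 1 ≤ t < k. Let D ⊆ U be a finite dataset, d' ∈ U with d' ∉ D and p d' y > 0, and D' = D ∪ {d'}; let j = I_{d'}(y). If |C_j(D, y)| ≥ t, then q(D', j, y) ≤ exp(ε₀) · (1 + γ/t) · q(D, j, y). -/
open Finset

attribute [local instance] Classical.propDecidable

noncomputable section PD

variable {U : Type*}

/-- Partition number: the unique `i : ℕ` with `γ^{-(i+1)} < x ≤ γ^{-i}` (for `0 < x ≤ 1`),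
    given by `⌊-log_γ x⌋`. -/
def Ipart (γ x : ℝ) : ℕ := ⌊-Real.logb γ x⌋₊

/-- Partition set `C_i(D, y) = {d ∈ D : p d y > 0 ∧ I_d(y) = i}`. -/
def Cpart (p : U → U → ℝ) (γ : ℝ) (D : Finset U) (y : U) (i : ℕ) : Finset U :=
  D.filter fun d => 0 < p d y ∧ Ipart γ (p d y) = i

/-- Laplace upper-tail function `Pr[L ≥ x]` for `L ~ Lap(1/ε₀)`. -/
def lapTail (ε₀ x : ℝ) : ℝ :=
  if 0 ≤ x then (1 / 2) * Real.exp (-(ε₀ * x)) else 1 - (1 / 2) * Real.exp (ε₀ * x)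

/-- Probability of passing the randomized privacy test from partition `i`. -/
def pt (p : U → U → ℝ) (γ ε₀ : ℝ) (k : ℕ) (D : Finset U) (i : ℕ) (y : U) : ℝ :=
  lapTail ε₀ ((k : ℝ) - ((Cpart p γ D y i).card : ℝ))

/-- Probability of producing `y` from partition `i`. -/
def q (p : U → U → ℝ) (γ ε₀ : ℝ) (k : ℕ) (D : Finset U) (i : ℕ) (y : U) : ℝ :=
  pt p γ ε₀ k D i y * ∑ s ∈ Cpart p γ D y i, p s y

/-- Probability that the mechanism `F` on input dataset `D` releases `y`. -/
def PF (p : U → U → ℝ) (γ ε₀ : ℝ) (k : ℕ) (D : Finset U) (y : U) : ℝ :=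
  (1 / (D.card : ℝ)) *
    ∑ s ∈ D.filter (fun s => 0 < p s y), p s y * pt p γ ε₀ k D (Ipart γ (p s y)) y

theorem lapTail_pos {ε₀ : ℝ} (hε : 0 < ε₀) (x : ℝ) : 0 < lapTail ε₀ x := by
  unfold lapTail
  split_ifs with h
  · positivity
  · have : Real.exp (ε₀ * x) ≤ 1 := Real.exp_le_one_iff.mpr (by nlinarith)
    linarith

theorem lapTail_sub_one_le {ε₀ : ℝ} (hε : 0 < ε₀) (x : ℝ) :
    lapTail ε₀ (x - 1) ≤ Real.exp ε₀ * lapTail ε₀ x := by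
  have hE : 1 < Real.exp ε₀ := Real.one_lt_exp_iff.mpr hε
  unfold lapTail
  split_ifs with h₁ h₂ h₂
  · refine le_of_eq ?_
    rw [mul_left_comm, ← Real.exp_add]
    ring_nf
  · linarith
  · rw [mul_left_comm, ← Real.exp_add]
    have hsum : ε₀ * (x - 1) = -(ε₀ + -(ε₀ * x)) := by ring
    rw [hsum, Real.exp_neg]
    have ha := Real.exp_pos (ε₀ + -(ε₀ * x))
    set a := Real.exp (ε₀ + -(ε₀ * x))
    have hinv : a * a⁻¹ = 1 := mul_inv_cancel₀ ha.ne'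
    have hai : 0 < a⁻¹ := inv_pos.mpr ha
    nlinarith [mul_nonneg hai.le (sq_nonneg (a - 1))]
  · have hu : Real.exp (ε₀ * x) ≤ 1 := Real.exp_le_one_iff.mpr (by nlinarith)
    have hu₀ := Real.exp_pos (ε₀ * x)
    have hv : Real.exp (ε₀ * x) = Real.exp (ε₀ * (x - 1)) * Real.exp ε₀ := by
      rw [← Real.exp_add]
      ring_nf
    have hw := Real.exp_pos (ε₀ * (x - 1))
    rw [hv] at hu hu₀ ⊢
    set E := Real.exp ε₀
    set w := Real.exp (ε₀ * (x - 1))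
    have hwE : w ≤ w * E := le_mul_of_one_le_right hw.le hE.le
    nlinarith [mul_nonneg (sub_nonneg.mpr hE.le) (show 0 ≤ 1 - (w * E + w) / 2 by linarith)]

theorem le_mul_of_Ipart_eq {γ x z : ℝ} (hγ : 1 < γ) (hx : 0 < x) (hx1 : x ≤ 1)
    (hz : 0 < z) (h : Ipart γ x = Ipart γ z) : x ≤ γ * z := by
  have hγ₀ : 0 < γ := by linarith
  have hlog : 0 ≤ -Real.logb γ x := neg_nonneg.mpr (Real.logb_nonpos hγ hx.le hx1)
  have h₁ : (Ipart γ x : ℝ) ≤ -Real.logb γ x := Nat.floor_le hlog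
  have h₂ : -Real.logb γ z < (Ipart γ z : ℝ) + 1 := Nat.lt_floor_add_one _
  rw [← h] at h₂
  rw [← Real.logb_le_logb hγ hx (by positivity), Real.logb_mul hγ₀.ne' hz.ne',
    Real.logb_self_eq_one hγ]
  linarith

theorem Cpart_insert {p : U → U → ℝ} {γ : ℝ} (D : Finset U) {d y : U} (hd : 0 < p d y) :
    Cpart p γ (insert d D) y (Ipart γ (p d y)) =
      insert d (Cpart p γ D y (Ipart γ (p d y))) := by
  unfold Cpart
  rw [Finset.filter_insert, if_pos ⟨hd, rfl⟩]

/-- If the partition `j = I_{d'}(y)` of the added record contains at least `t` records,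
then `q(D', j, y) ≤ e^{ε₀} · (1 + γ/t) · q(D, j, y)`. -/
theorem q_added_partition_large (γ ε₀ : ℝ) (hγ : 1 < γ) (hε : 0 < ε₀)
    (k : ℕ) (hk : 1 ≤ k) (t : ℕ) (ht : 1 ≤ t) (htk : t < k)
    (p : U → U → ℝ) (hp : ∀ d y, 0 ≤ p d y ∧ p d y ≤ 1)
    (D : Finset U) (d' : U) (hd' : d' ∉ D) (D' : Finset U) (hD' : D' = insert d' D)
    (y : U) (hpos : 0 < p d' y) (j : ℕ) (hj : j = Ipart γ (p d' y))
    (hlarge : t ≤ (Cpart p γ D y j).card) :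
    q p γ ε₀ k D' j y ≤ Real.exp ε₀ * (1 + γ / (t : ℝ)) * q p γ ε₀ k D j y := by
  subst hD' hj
  have ht₀ : (0 : ℝ) < t := by exact_mod_cast ht
  unfold q pt
  rw [Cpart_insert D hpos]
  set C := Cpart p γ D y (Ipart γ (p d' y)) with hC
  have hmem : d' ∉ C := fun h => hd' (Finset.mem_filter.mp h).1
  rw [Finset.card_insert_of_notMem hmem, Finset.sum_insert hmem]
  have hsum : (t : ℝ) * p d' y ≤ γ * ∑ s ∈ C, p s y := by
    calc (t : ℝ) * p d' y ≤ (C.card : ℝ) * p d' y := by gcongr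
      _ = ∑ _s ∈ C, p d' y := by rw [Finset.sum_const, nsmul_eq_mul]
      _ ≤ ∑ s ∈ C, γ * p s y := Finset.sum_le_sum fun s hs => by
          have hs' := (Finset.mem_filter.mp hs).2
          exact le_mul_of_Ipart_eq hγ hpos (hp d' y).2 hs'.1 hs'.2.symm
      _ = γ * ∑ s ∈ C, p s y := (Finset.mul_sum ..).symm
  have hadd : p d' y + ∑ s ∈ C, p s y ≤ (1 + γ / t) * ∑ s ∈ C, p s y := by
    have : p d' y ≤ γ / t * ∑ s ∈ C, p s y := by
      rw [div_mul_eq_mul_div, le_div_iff₀ ht₀]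
      linarith
    linarith
  have hsum₀ : 0 ≤ ∑ s ∈ C, p s y := Finset.sum_nonneg fun s _ => (hp s y).1
  have htail := lapTail_sub_one_le hε ((k : ℝ) - (C.card : ℝ))
  have hcast : (k : ℝ) - ((C.card + 1 : ℕ) : ℝ) = (k : ℝ) - (C.card : ℝ) - 1 := by
    push_cast
    ring
  rw [hcast]
  calc lapTail ε₀ ((k : ℝ) - (C.card : ℝ) - 1) * (p d' y + ∑ s ∈ C, p s y)
      ≤ (Real.exp ε₀ * lapTail ε₀ ((k : ℝ) - (C.card : ℝ))) *
          ((1 + γ / t) * ∑ s ∈ C, p s y) :=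
        mul_le_mul htail hadd (add_nonneg hpos.le hsum₀)
          (mul_pos (Real.exp_pos _) (lapTail_pos hε _)).le
    _ = _ := by ring

end PD
end

section
/- In the plausible-deniability mechanism setup, let t be an integer with 1 ≤ t < k, let ε = ε₀ + ln(1 + γ/t), let D ⊆ U be a finite dataset with |D| ≥ k, let d' ∈ U with d' ∉ D, and let D' = D ∪ {d'}. Then for every synthetic record y ∈ U: PF(D, y) ≤ exp(ε) · PF(D', y). -/
open Finset

attribute [local instance] Classical.propDecidable

noncomputable section PD

variable {U : Type*}

theorem lapTail_antitone {ε₀ : ℝ} (hε : 0 < ε₀) : Antitone (lapTail ε₀) := by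
  intro a b hab
  have hmul : ε₀ * a ≤ ε₀ * b := mul_le_mul_of_nonneg_left hab hε.le
  unfold lapTail
  split_ifs with hb ha ha
  · have : Real.exp (-(ε₀ * b)) ≤ Real.exp (-(ε₀ * a)) := Real.exp_le_exp.2 (by linarith)
    linarith
  · have h₁ : Real.exp (-(ε₀ * b)) ≤ 1 :=
      Real.exp_le_one_iff.2 (by linarith [mul_nonneg hε.le hb])
    have h₂ : Real.exp (ε₀ * a) ≤ 1 :=
      Real.exp_le_one_iff.2 (mul_nonpos_of_nonneg_of_nonpos hε.le (not_le.1 ha).le)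
    linarith
  · exact absurd (ha.trans hab) hb
  · have : Real.exp (ε₀ * a) ≤ Real.exp (ε₀ * b) := Real.exp_le_exp.2 hmul
    linarith

theorem lapTail_nonneg {ε₀ : ℝ} (hε : 0 < ε₀) (x : ℝ) : 0 ≤ lapTail ε₀ x := by
  unfold lapTail
  split_ifs with hx
  · positivity
  · have : Real.exp (ε₀ * x) ≤ 1 :=
      Real.exp_le_one_iff.2 (mul_nonpos_of_nonneg_of_nonpos hε.le (not_le.1 hx).le)
    linarith

theorem pt_nonneg (p : U → U → ℝ) (γ : ℝ) {ε₀ : ℝ} (hε : 0 < ε₀) (k : ℕ) (D : Finset U)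
    (i : ℕ) (y : U) : 0 ≤ pt p γ ε₀ k D i y :=
  lapTail_nonneg hε _

theorem pt_mono (p : U → U → ℝ) (γ : ℝ) {ε₀ : ℝ} (hε : 0 < ε₀) (k : ℕ) {D E : Finset U}
    (hDE : D ⊆ E) (i : ℕ) (y : U) : pt p γ ε₀ k D i y ≤ pt p γ ε₀ k E i y := by
  have hcard : ((Cpart p γ D y i).card : ℝ) ≤ ((Cpart p γ E y i).card : ℝ) :=
    Nat.cast_le.2 (Finset.card_le_card (Finset.filter_subset_filter _ hDE))
  exact lapTail_antitone hε (by linarith)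

theorem sum_mul_pt_mono (p : U → U → ℝ) (γ : ℝ) {ε₀ : ℝ} (hε : 0 < ε₀) (k : ℕ)
    {D E : Finset U} (hDE : D ⊆ E) (y : U) :
    ∑ s ∈ D.filter (fun s => 0 < p s y), p s y * pt p γ ε₀ k D (Ipart γ (p s y)) y ≤
      ∑ s ∈ E.filter (fun s => 0 < p s y), p s y * pt p γ ε₀ k E (Ipart γ (p s y)) y := by
  refine (Finset.sum_le_sum fun s hs => mul_le_mul_of_nonneg_left
    (pt_mono p γ hε k hDE _ y) (Finset.mem_filter.1 hs).2.le).trans ?_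
  exact Finset.sum_le_sum_of_subset_of_nonneg (Finset.filter_subset_filter _ hDE)
    fun s hs _ => mul_nonneg (Finset.mem_filter.1 hs).2.le (pt_nonneg p γ hε k E _ y)

/-- First half of the core differential-privacy lemma:
`Pr[F(D) = y] ≤ e^ε · Pr[F(D') = y]` for `ε = ε₀ + ln(1 + γ/t)`. -/
theorem PF_le_exp_mul_PF_insert (γ ε₀ : ℝ) (hγ : 1 < γ) (hε : 0 < ε₀)
    (k : ℕ) (hk : 1 ≤ k) (t : ℕ) (ht : 1 ≤ t) (htk : t < k)
    (ε : ℝ) (hεdef : ε = ε₀ + Real.log (1 + γ / (t : ℝ)))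
    (p : U → U → ℝ) (hp : ∀ d y, 0 ≤ p d y ∧ p d y ≤ 1)
    (D : Finset U) (hD : k ≤ D.card)
    (d' : U) (hd' : d' ∉ D) (D' : Finset U) (hD' : D' = insert d' D) (y : U) :
    PF p γ ε₀ k D y ≤ Real.exp ε * PF p γ ε₀ k D' y := by
  subst hD' hεdef
  have ht₀ : (0 : ℝ) < t := by exact_mod_cast ht
  have htn : (t : ℝ) ≤ D.card := by exact_mod_cast htk.le.trans hD
  have hn : (0 : ℝ) < D.card := ht₀.trans_le htn
  have hexp : 1 + 1 / (D.card : ℝ) ≤ Real.exp (ε₀ + Real.log (1 + γ / (t : ℝ))) := by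
    have hγt : 1 / (D.card : ℝ) ≤ γ / t := by gcongr
    have hpos : 0 < 1 + γ / (t : ℝ) := by positivity
    rw [Real.exp_add, Real.exp_log hpos]
    exact (add_le_add_right hγt 1).trans
      (le_mul_of_one_le_left hpos.le (Real.one_le_exp hε.le))
  have hsum := sum_mul_pt_mono p γ hε k (Finset.subset_insert d' D) y
  have hS : 0 ≤ ∑ s ∈ D.filter (fun s => 0 < p s y),
      p s y * pt p γ ε₀ k D (Ipart γ (p s y)) y :=
    Finset.sum_nonneg fun s hs =>
      mul_nonneg (Finset.mem_filter.1 hs).2.le (pt_nonneg p γ hε k D _ y)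
  have hcoef : 1 / (D.card : ℝ) ≤ Real.exp (ε₀ + Real.log (1 + γ / (t : ℝ))) *
      (1 / ((insert d' D).card : ℝ)) := by
    rw [Finset.card_insert_of_notMem hd', Nat.cast_add_one, mul_one_div, le_div_iff₀ (by positivity)]
    refine le_trans (le_of_eq ?_) hexp
    field_simp
  unfold PF
  rw [← mul_assoc]
  exact mul_le_mul hcoef hsum hS (by positivity)

end PD
end
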